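/- Let (X_n) be a sequence of n×n unitarily invariant random matrices with noncommutative entries which has asymptotically vanishing commutators up to degree m₀, and assume that the limit K_{(V,π)} = lim_{n→∞} n^{|(V,π)|} κ_{(V,π)} exists and is finite for all partitioned permutations (V,π) of {1,…,m} for every m < m₀. Then lim_{n→∞} n^{|(V,π)|}(κ_{(V,π)} − κ_{(W,σ)}) = 0 whenever (V,π) and (W,σ) are conjugate partitioned permutations of {1,…,m} for some m ≤ m₀. -/

import Mathlib

open scoped Classical BigOperators
open Filter

noncomputable section

namespace HOF

instance setoidFinite {α : Type*} [Finite α] : Finite (Setoid α) :=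
  Finite.of_injective (fun V : Setoid α => V.r)
    (fun V W h => Setoid.ext fun a b => by rw [show V.r = W.r from h])

instance setoidFintype {α : Type*} [Finite α] : Fintype (Setoid α) := Fintype.ofFinite _

instance matrixMeasurableSpace {n : ℕ} : MeasurableSpace (Matrix (Fin n) (Fin n) ℂ) :=
  MeasurableSpace.pi

variable {A : Type*}

/-- Ordered product of the `a i` over the indices in `S`, in increasing order of indices. -/
def ordProd [Monoid A] {l : ℕ} (a : Fin l → A) (S : Set (Fin l)) : A :=
  (((List.finRange l).filter (fun i => decide (i ∈ S))).map a).prod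

/-- The moment functional `E_V` associated to a set partition `V` (encoded as a `Setoid`):
the product over the blocks of `V` of `E` applied to the ordered product over each block. -/
def momentV {R : Type*} [CommRing R] [Monoid A] {l : ℕ} (E : A → R)
    (V : Setoid (Fin l)) (a : Fin l → A) : R :=
  ∏ᶠ B ∈ Setoid.classes V, E (ordProd a B)

/-- `k` is the family of tensor cumulants associated to the expectation `E`:
for every partition `V`, `∑_{W ≤ V} k_W = E_V`. -/
def IsCumulant {R : Type*} [CommRing R] [Monoid A] (E : A → R)
    (k : ∀ {l : ℕ}, Setoid (Fin l) → (Fin l → A) → R) : Prop :=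
  ∀ (l : ℕ) (V : Setoid (Fin l)) (a : Fin l → A),
    ∑ W ∈ Finset.univ.filter (fun W : Setoid (Fin l) => W ≤ V), k W a = momentV E V a

/-- Number of blocks of a partition. -/
def numBlocks {l : ℕ} (V : Setoid (Fin l)) : ℕ := (Setoid.classes V).ncard

/-- The partition of cycles of a permutation. -/
def cycleSetoid {l : ℕ} (π : Equiv.Perm (Fin l)) : Setoid (Fin l) :=
  ⟨π.SameCycle, ⟨fun x => Equiv.Perm.SameCycle.refl π x, fun h => h.symm, fun h h' => h.trans h'⟩⟩

/-- Number of cycles of a permutation. -/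
def numCycles {l : ℕ} (π : Equiv.Perm (Fin l)) : ℕ := numBlocks (cycleSetoid π)

/-- `π ≤ V` : every cycle of `π` is contained in a block of `V`, i.e. `(V, π)` is a
partitioned permutation. -/
def permLePartition {l : ℕ} (π : Equiv.Perm (Fin l)) (V : Setoid (Fin l)) : Prop :=
  ∀ i, V.r i (π i)

/-- Length `|π| = l - #π` of a permutation. -/
def permLen {l : ℕ} (π : Equiv.Perm (Fin l)) : ℤ := (l : ℤ) - numCycles π

/-- Length `|(V,π)| = |π| + 2(#π - #V)` of a partitioned permutation. -/
def ppLen {l : ℕ} (V : Setoid (Fin l)) (π : Equiv.Perm (Fin l)) : ℤ :=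
  ((l : ℤ) - numCycles π) + 2 * ((numCycles π : ℤ) - numBlocks V)

/-- The order `(V,π) ≤ (W,σ)` on partitioned permutations, i.e.
`(V,π) ⬝ (0, π⁻¹σ) = (W,σ)` (with lengths adding up). -/
def ppLe {l : ℕ} (V : Setoid (Fin l)) (π : Equiv.Perm (Fin l))
    (W : Setoid (Fin l)) (σ : Equiv.Perm (Fin l)) : Prop :=
  V ⊔ cycleSetoid (π⁻¹ * σ) = W ∧ ppLen V π + permLen (π⁻¹ * σ) = ppLen W σ

/-- `(V,π)` and `(W,τ)` are conjugate by the permutation `σ`. -/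
def ppConjBy {l : ℕ} (σ : Equiv.Perm (Fin l)) (V : Setoid (Fin l)) (π : Equiv.Perm (Fin l))
    (W : Setoid (Fin l)) (τ : Equiv.Perm (Fin l)) : Prop :=
  τ = σ * π * σ⁻¹ ∧ ∀ a b, W.r a b ↔ V.r (σ⁻¹ a) (σ⁻¹ b)

/-- `(V,π)` and `(W,τ)` are conjugate partitioned permutations. -/
def ppConj {l : ℕ} (V : Setoid (Fin l)) (π : Equiv.Perm (Fin l))
    (W : Setoid (Fin l)) (τ : Equiv.Perm (Fin l)) : Prop :=
  ∃ σ : Equiv.Perm (Fin l), ppConjBy σ V π W τ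

/-- The `(i,j)` entry of `U X U⁻¹ = U X U*` for a unitary `U` (with complex entries) and a
matrix `X` with noncommutative entries. -/
def conjEntry [Ring A] [Algebra ℂ A] {n : ℕ} (U : Matrix (Fin n) (Fin n) ℂ)
    (X : Matrix (Fin n) (Fin n) A) (i j : Fin n) : A :=
  ∑ a : Fin n, ∑ b : Fin n, (U i a * star (U j b)) • X a b

/-- A random matrix with noncommutative entries is unitarily invariant if for every unitary `U`
the joint distribution (all joint moments under `E`) of the entries of `U X U⁻¹` coincides with
that of the entries of `X`. -/
def UnitarilyInvariant [Ring A] [Algebra ℂ A] (E : A → ℂ) {n : ℕ}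
    (X : Matrix (Fin n) (Fin n) A) : Prop :=
  ∀ U ∈ Matrix.unitaryGroup (Fin n) ℂ, ∀ (m : ℕ) (i j : Fin m → Fin n),
    E (List.ofFn (fun t => conjEntry U X (i t) (j t))).prod
      = E (List.ofFn (fun t => X (i t) (j t))).prod

/-- `κ_{(V,π)} = k_V(X_{1π(1)}, …, X_{mπ(m)})`. -/
def kappa {n : ℕ} (k : ∀ {l : ℕ}, Setoid (Fin l) → (Fin l → A) → ℂ)
    (X : Matrix (Fin n) (Fin n) A) {m : ℕ} (h : m ≤ n)
    (V : Setoid (Fin m)) (π : Equiv.Perm (Fin m)) : ℂ :=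
  k V (fun t => X (Fin.castLE h t) (Fin.castLE h (π t)))

/-- The sequence `n ↦ κ_{(V,π)}(X_n)` (with junk value `0` for `n < m`). -/
def kappaSeq {A : ℕ → Type*} (k : ∀ n, ∀ {l : ℕ}, Setoid (Fin l) → (Fin l → A n) → ℂ)
    (X : ∀ n, Matrix (Fin n) (Fin n) (A n)) {m : ℕ}
    (V : Setoid (Fin m)) (π : Equiv.Perm (Fin m)) (n : ℕ) : ℂ :=
  if h : m ≤ n then kappa (k n) (X n) h V π else 0

/-- Normalized trace of a matrix with entries in a `ℂ`-algebra. -/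
def ncTrace [Ring A] [Algebra ℂ A] {n : ℕ} (X : Matrix (Fin n) (Fin n) A) : A :=
  ((n : ℂ)⁻¹) • Matrix.trace X

/-- Partial sums `p₁ + ⋯ + p_j`. -/
def psum {l : ℕ} (p : Fin l → ℕ) (j : ℕ) : ℕ := ∑ i : Fin l, if (i : ℕ) < j then p i else 0

/-- `γ` is the permutation with the cycles `(1,…,p₁)(p₁+1,…,p₁+p₂)⋯`. -/
def IsCycleType {l k : ℕ} (p : Fin l → ℕ) (γ : Equiv.Perm (Fin k)) : Prop :=
  psum p l = k ∧
  (∀ (j : ℕ), j < l → ∀ t : Fin k, psum p j ≤ (t : ℕ) → (t : ℕ) + 1 < psum p (j + 1) →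
    ((γ t : Fin k) : ℕ) = (t : ℕ) + 1) ∧
  (∀ (j : ℕ), j < l → ∀ t : Fin k, (t : ℕ) + 1 = psum p (j + 1) → ((γ t : Fin k) : ℕ) = psum p j)

/-- The section `Fin (m-1) → Fin m` merging `i` and `i+1` (both are hit by `i`). -/
def mergeEmb (m i : ℕ) (_hi : i + 1 < m) (t : Fin (m - 1)) : Fin m :=
  if (t : ℕ) ≤ i then ⟨t, by have := t.isLt; omega⟩ else ⟨(t : ℕ) + 1, by have := t.isLt; omega⟩

/-- The partition of `{1,…,m-1}` obtained from a partition of `{1,…,m}` by merging the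
elements `i` and `i+1` into a single element. -/
def mergeSetoid {m : ℕ} (W : Setoid (Fin m)) (i : ℕ) (hi : i + 1 < m) : Setoid (Fin (m - 1)) :=
  Setoid.comap (mergeEmb m i hi) W

/-- The tuple `(a₁, …, a_{i-1}, [a_i, a_{i+1}], a_{i+2}, …, a_m)` of length `m-1`. -/
def mergeSeq [Ring A] {m : ℕ} (a : Fin m → A) (i : ℕ) (hi : i + 1 < m)
    (t : Fin (m - 1)) : A :=
  if (t : ℕ) < i then a ⟨t, by have := t.isLt; omega⟩
  else if (t : ℕ) = i then
    a ⟨i, by omega⟩ * a ⟨i + 1, hi⟩ - a ⟨i + 1, hi⟩ * a ⟨i, by omega⟩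
  else a ⟨(t : ℕ) + 1, by have := t.isLt; omega⟩


/-- The sequence `(X_n)` has asymptotically vanishing commutators up to degree `m₀`:
for every partitioned permutation `(V,π)` of `{1,…,m}` with `m ≤ m₀` and neighboring indices
`i`, `i+1` lying in the same block of `V`, the cumulant (over the merged partition) of the tuple
`(X_{1π(1)},…,[X_{iπ(i)},X_{i+1,π(i+1)}],…,X_{mπ(m)})` is `o(n^{-|(V,π)|})`. -/
def AsympVanishingComm {A : ℕ → Type*} [∀ n, Ring (A n)]
    (k : ∀ n, ∀ {l : ℕ}, Setoid (Fin l) → (Fin l → A n) → ℂ)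
    (X : ∀ n, Matrix (Fin n) (Fin n) (A n)) (m₀ : ℕ) : Prop :=
  ∀ (m : ℕ), m ≤ m₀ →
    ∀ (V : Setoid (Fin m)) (π : Equiv.Perm (Fin m)), permLePartition π V →
    ∀ (i : ℕ) (hi : i + 1 < m), V.r ⟨i, by omega⟩ ⟨i + 1, hi⟩ →
      Tendsto (fun n : ℕ => (n : ℂ) ^ (ppLen V π) *
          (if h : m ≤ n then
            k n (mergeSetoid V i hi)
              (mergeSeq (fun t => X n (Fin.castLE h t) (Fin.castLE h (π t))) i hi)
          else 0))
        atTop (nhds 0)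

section Partitions

theorem eq_of_sum_le_eq {P R : Type*} [PartialOrder P] [Fintype P] [AddCommGroup R] {F G : P → R}
    (V : P)
    (h : ∀ U ≤ V, ∑ W ∈ Finset.univ.filter (fun W => W ≤ U), F W
      = ∑ W ∈ Finset.univ.filter (fun W => W ≤ U), G W) : F V = G V := by
  induction V using WellFoundedLT.induction with
  | ind V ih =>
    have hV := h V le_rfl
    have hmem : V ∈ Finset.univ.filter (fun W => W ≤ V) := by simp
    rw [← Finset.add_sum_erase _ _ hmem, ← Finset.add_sum_erase _ G hmem,
      Finset.sum_congr rfl (g := G)] at hV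
    · exact add_right_cancel hV
    · intro W hW
      have hlt : W < V := lt_of_le_of_ne (by simpa using (Finset.mem_erase.1 hW).2)
        (Finset.ne_of_mem_erase hW)
      exact ih W hlt fun U hU => h U (hU.trans hlt.le)

theorem classes_comap {α β : Type*} {φ : α → β} (hφ : Function.Surjective φ) (V : Setoid β) :
    (Setoid.comap φ V).classes = (fun B => φ ⁻¹' B) '' V.classes := by
  ext S
  constructor
  · rintro ⟨y, rfl⟩
    exact ⟨_, V.mem_classes (φ y), rfl⟩
  · rintro ⟨B, ⟨y, rfl⟩, rfl⟩
    obtain ⟨x, rfl⟩ := hφ y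
    exact ⟨x, rfl⟩

theorem map_le_iff_le_comap {α β : Type*} (f : α → β) (U : Setoid α) (W : Setoid β) :
    U.map f ≤ W ↔ U ≤ W.comap f := by
  refine ⟨fun h => Setoid.le_comap_map.trans fun _ _ hab => h hab,
    fun h => Setoid.eqvGen_le ?_⟩
  rintro _ _ ⟨a, b, hab, rfl, rfl⟩
  exact h hab

theorem map_comap_of_surjective {α β : Type*} {f : α → β} (hf : Function.Surjective f)
    (W : Setoid β) : (W.comap f).map f = W := by
  refine le_antisymm ((map_le_iff_le_comap f _ W).2 le_rfl) fun x y h => ?_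
  obtain ⟨a, rfl⟩ := hf x
  obtain ⟨b, rfl⟩ := hf y
  exact Relation.EqvGen.rel _ _ ⟨a, b, h, rfl, rfl⟩

theorem comap_perm_le_iff {α : Type*} (σ : Equiv.Perm α) (U V : Setoid α) :
    U.comap σ ≤ V.comap σ ↔ U ≤ V := by
  refine ⟨fun h x y hxy => ?_, fun h _ _ hxy => h hxy⟩
  have := @h (σ⁻¹ x) (σ⁻¹ y) (by simpa [Setoid.comap_rel] using hxy)
  simpa [Setoid.comap_rel] using this

theorem comap_comap_inv {α : Type*} (σ : Equiv.Perm α) (V : Setoid α) :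
    (V.comap (⇑σ⁻¹)).comap σ = V := by
  ext x y
  simp [Setoid.comap_rel]

theorem map_comap_perm {α β : Type*} (σ : Equiv.Perm α) {f : α → β} (hf : f ∘ σ = f)
    (U : Setoid α) : (U.comap σ).map f = U.map f := by
  refine eq_of_forall_ge_iff fun W => ?_
  rw [map_le_iff_le_comap, map_le_iff_le_comap, ← comap_perm_le_iff σ U (W.comap f),
    ← Setoid.comap_comp W f, hf]

theorem numBlocks_comap {l : ℕ} (σ : Equiv.Perm (Fin l)) (V : Setoid (Fin l)) :
    numBlocks (V.comap σ) = numBlocks V := by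
  rw [numBlocks, classes_comap σ.surjective,
    Set.ncard_image_of_injective _ (Set.preimage_injective.2 σ.surjective), numBlocks]

theorem ppLen_conj {l : ℕ} (σ : Equiv.Perm (Fin l)) (V : Setoid (Fin l))
    (π : Equiv.Perm (Fin l)) :
    ppLen (V.comap (⇑σ⁻¹)) (σ * π * σ⁻¹) = ppLen V π := by
  have h : cycleSetoid (σ * π * σ⁻¹) = (cycleSetoid π).comap (⇑σ⁻¹) :=
    Setoid.ext fun _ _ => Equiv.Perm.sameCycle_conj
  rw [ppLen, ppLen, numCycles, numCycles, h, numBlocks_comap, numBlocks_comap]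

theorem permLePartition_conj {l : ℕ} (σ : Equiv.Perm (Fin l)) {V : Setoid (Fin l)}
    {π : Equiv.Perm (Fin l)} (h : permLePartition π V) :
    permLePartition (σ * π * σ⁻¹) (V.comap (⇑σ⁻¹)) := fun i => by
  change V (σ⁻¹ i) (σ⁻¹ ((σ * π * σ⁻¹) i))
  simpa using h (σ⁻¹ i)

end Partitions

section Moments

theorem momentV_comap {R : Type*} [CommRing R] [Monoid A] {l l' : ℕ} (E : A → R)
    {φ : Fin l → Fin l'} (hφ : Function.Surjective φ) (V : Setoid (Fin l')) (a : Fin l → A) :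
    momentV E (V.comap φ) a = ∏ᶠ B ∈ Setoid.classes V, E (ordProd a (φ ⁻¹' B)) := by
  rw [momentV, classes_comap hφ]
  exact finprod_mem_image (Set.preimage_injective.2 hφ).injOn

theorem momentV_congr {R : Type*} [CommRing R] [Monoid A] {l l' : ℕ} (E : A → R)
    {φ : Fin l → Fin l'} (hφ : Function.Surjective φ) (V : Setoid (Fin l')) (a : Fin l → A)
    (b : Fin l' → A)
    (h : ∀ B ∈ Setoid.classes V, E (ordProd a (φ ⁻¹' B)) = E (ordProd b B)) :
    momentV E (V.comap φ) a = momentV E V b := by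
  rw [momentV_comap E hφ, momentV]
  exact finprod_mem_congr rfl h

theorem val_swap_succ {m i : ℕ} (hi : i + 1 < m) (t : Fin m) :
    (Equiv.swap (⟨i, by omega⟩ : Fin m) ⟨i + 1, hi⟩ t : ℕ)
      = if (t : ℕ) = i then i + 1 else if (t : ℕ) = i + 1 then i else t := by
  rw [Equiv.swap_apply_def]
  simp only [Fin.ext_iff]
  split_ifs <;> rfl

theorem ordProd_swap [Monoid A] {m : ℕ} (i : ℕ) (hi : i + 1 < m) (a : Fin m → A)
    (B : Set (Fin m)) (hB : ¬ ((⟨i, by omega⟩ : Fin m) ∈ B ∧ (⟨i + 1, hi⟩ : Fin m) ∈ B)) :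
    ordProd (a ∘ Equiv.swap ⟨i, by omega⟩ ⟨i + 1, hi⟩)
      (Equiv.swap (⟨i, by omega⟩ : Fin m) ⟨i + 1, hi⟩ ⁻¹' B) = ordProd a B := by
  set τ := Equiv.swap (⟨i, by omega⟩ : Fin m) ⟨i + 1, hi⟩ with hτ
  unfold ordProd
  rw [← List.map_map]
  congr 2
  refine List.Pairwise.eq_of_mem_iff (r := (· < ·)) ?_
    ((List.pairwise_lt_finRange m).filter _) fun x => ?_
  · rw [List.pairwise_map]
    refine ((List.pairwise_lt_finRange m).filter _).imp_of_mem fun {s t} hs ht hst => ?_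
    have hs' : τ s ∈ B := by simpa using hs
    have ht' : τ t ∈ B := by simpa using ht
    by_cases hst' : s = ⟨i, by omega⟩ ∧ t = ⟨i + 1, hi⟩
    · rw [hτ, hst'.1, Equiv.swap_apply_left] at hs'
      rw [hτ, hst'.2, Equiv.swap_apply_right] at ht'
      exact absurd ⟨ht', hs'⟩ hB
    · simp only [Fin.ext_iff] at hst'
      rw [Fin.lt_def] at hst ⊢
      rw [val_swap_succ, val_swap_succ]
      split_ifs <;> omega
  · simp only [List.mem_map, List.mem_filter, List.mem_finRange, true_and, decide_eq_true_eq,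
      Set.mem_preimage]
    exact ⟨by rintro ⟨y, hy, rfl⟩; exact hy, fun hx => ⟨τ⁻¹ x, by simpa using hx, by simp⟩⟩

theorem ordProd_update_sub [Ring A] {l : ℕ} (a : Fin l → A) (j : Fin l) (x y : A)
    {B : Set (Fin l)} (hj : j ∈ B) :
    ordProd (Function.update a j (x - y)) B
      = ordProd (Function.update a j x) B - ordProd (Function.update a j y) B := by
  unfold ordProd
  have hmem : j ∈ (List.finRange l).filter (fun i => decide (i ∈ B)) := by simpa using hj
  have hnd := (List.nodup_finRange l).filter (fun i => decide (i ∈ B))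
  obtain ⟨s, t, hst⟩ := List.mem_iff_append.1 hmem
  rw [hst] at hnd ⊢
  have hs : j ∉ s := by
    intro h
    simp only [List.nodup_append, List.mem_cons] at hnd
    exact hnd.2.2 j h j (Or.inl rfl) rfl
  have ht : j ∉ t := fun h => by simp [List.nodup_append, h] at hnd
  have key : ∀ (z : A) (L : List (Fin l)), j ∉ L → L.map (Function.update a j z) = L.map a :=
    fun z L hL => List.map_congr_left fun u hu =>
      Function.update_of_ne (ne_of_mem_of_not_mem hu hL) _ _
  simp [key _ s hs, key _ t ht, sub_mul, mul_sub]

theorem ordProd_update_of_notMem [Monoid A] {l : ℕ} (a : Fin l → A) (j : Fin l) (x : A)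
    {B : Set (Fin l)} (hj : j ∉ B) :
    ordProd (Function.update a j x) B = ordProd a B := by
  unfold ordProd
  congr 1
  refine List.map_congr_left fun u hu => Function.update_of_ne ?_ _ _
  rintro rfl
  exact hj (by simpa using hu)

theorem momentV_update_sub {R : Type*} [CommRing R] [Ring A] {l : ℕ} (E : A →+ R)
    (V : Setoid (Fin l)) (a : Fin l → A) (j : Fin l) (x y : A) :
    momentV E V (Function.update a j (x - y))
      = momentV E V (Function.update a j x) - momentV E V (Function.update a j y) := by
  set B₀ : Set (Fin l) := {t | V t j}
  have hB₀ : B₀ ∈ V.classes := V.mem_classes j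
  have hjB : j ∈ B₀ := V.refl' j
  have key : ∀ z : A, momentV E V (Function.update a j z)
      = E (ordProd (Function.update a j z) B₀)
        * ∏ᶠ B ∈ V.classes \ {B₀}, E (ordProd a B) := by
    intro z
    rw [momentV, ← Set.insert_sdiff_self_of_mem hB₀,
      finprod_mem_insert _ (by simp) (Set.toFinite _), Set.insert_sdiff_self_of_mem hB₀]
    congr 1
    refine finprod_mem_congr rfl fun B hB => ?_
    rw [ordProd_update_of_notMem]
    exact fun hj => hB.2 (V.eq_of_mem_classes hB.1 hj hB₀ hjB)
  rw [key, key, key, ordProd_update_sub a j x y hjB, map_sub, sub_mul]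

end Moments

section Merge

/-- The surjection `Fin m → Fin (m-1)` identifying `i` and `i+1`. -/
def mergeMap (m i : ℕ) (hi : i + 1 < m) (t : Fin m) : Fin (m - 1) :=
  if h : (t : ℕ) ≤ i then ⟨t, by omega⟩ else ⟨(t : ℕ) - 1, by have := t.isLt; omega⟩

theorem val_mergeMap {m i : ℕ} (hi : i + 1 < m) (t : Fin m) :
    (mergeMap m i hi t : ℕ) = if (t : ℕ) ≤ i then (t : ℕ) else t - 1 := by
  unfold mergeMap
  split_ifs <;> rfl

theorem val_mergeEmb {m i : ℕ} (hi : i + 1 < m) (t : Fin (m - 1)) :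
    (mergeEmb m i hi t : ℕ) = if (t : ℕ) ≤ i then (t : ℕ) else t + 1 := by
  unfold mergeEmb
  split_ifs <;> rfl

theorem mergeMap_mergeEmb {m i : ℕ} (hi : i + 1 < m) (t : Fin (m - 1)) :
    mergeMap m i hi (mergeEmb m i hi t) = t := by
  ext
  rw [val_mergeMap, val_mergeEmb]
  split_ifs <;> omega

theorem mergeMap_surjective {m i : ℕ} (hi : i + 1 < m) : Function.Surjective (mergeMap m i hi) :=
  fun t => ⟨_, mergeMap_mergeEmb hi t⟩

theorem mergeMap_comp_swap {m i : ℕ} (hi : i + 1 < m) :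
    mergeMap m i hi ∘ Equiv.swap ⟨i, by omega⟩ ⟨i + 1, hi⟩ = mergeMap m i hi := by
  funext t
  ext
  rw [Function.comp_apply, val_mergeMap, val_mergeMap, val_swap_succ]
  split_ifs <;> omega

theorem comap_mergeMap_mergeSetoid {m i : ℕ} (hi : i + 1 < m) {V : Setoid (Fin m)}
    (hV : V ⟨i, by omega⟩ ⟨i + 1, hi⟩) :
    (mergeSetoid V i hi).comap (mergeMap m i hi) = V := by
  have h : ∀ t, V (mergeEmb m i hi (mergeMap m i hi t)) t := by
    intro t
    by_cases ht : (t : ℕ) = i + 1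
    · have h1 : mergeEmb m i hi (mergeMap m i hi t) = ⟨i, by omega⟩ := by
        ext
        rw [val_mergeEmb, val_mergeMap]
        split_ifs <;> simp <;> omega
      have h2 : t = ⟨i + 1, hi⟩ := Fin.ext ht
      rw [h1]
      simpa only [h2] using hV
    · have h1 : mergeEmb m i hi (mergeMap m i hi t) = t := by
        ext
        rw [val_mergeEmb, val_mergeMap]
        split_ifs <;> omega
      rw [h1]
  ext x y
  exact ⟨fun hxy => V.trans' (V.symm' (h x)) (V.trans' hxy (h y)),
    fun hxy => V.trans' (h x) (V.trans' hxy (V.symm' (h y)))⟩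

/-- The tuple `(a₁, …, a_{i-1}, a_i a_{i+1}, a_{i+2}, …, a_m)` of length `m-1`. -/
def prodSeq [Mul A] {m : ℕ} (a : Fin m → A) (i : ℕ) (hi : i + 1 < m) (t : Fin (m - 1)) : A :=
  if (t : ℕ) < i then a ⟨t, by have := t.isLt; omega⟩
  else if (t : ℕ) = i then a ⟨i, by omega⟩ * a ⟨i + 1, hi⟩
  else a ⟨(t : ℕ) + 1, by have := t.isLt; omega⟩

theorem mergeSeq_eq_update [Ring A] {m i : ℕ} (hi : i + 1 < m) (a : Fin m → A) :
    mergeSeq a i hi = Function.update (prodSeq a i hi) ⟨i, by omega⟩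
      (a ⟨i, by omega⟩ * a ⟨i + 1, hi⟩ - a ⟨i + 1, hi⟩ * a ⟨i, by omega⟩) := by
  funext t
  unfold mergeSeq prodSeq
  by_cases ht : (t : ℕ) = i
  · simp [Function.update_apply, Fin.ext_iff, ht]
  · simp [Fin.ext_iff, ht]

theorem prodSeq_eq_update [Ring A] {m i : ℕ} (hi : i + 1 < m) (a : Fin m → A) :
    prodSeq a i hi = Function.update (prodSeq a i hi) ⟨i, by omega⟩
      (a ⟨i, by omega⟩ * a ⟨i + 1, hi⟩) := by
  rw [eq_comm, Function.update_eq_self_iff]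
  simp [prodSeq]

theorem prodSeq_swap_eq_update [Ring A] {m i : ℕ} (hi : i + 1 < m) (a : Fin m → A) :
    prodSeq (a ∘ Equiv.swap ⟨i, by omega⟩ ⟨i + 1, hi⟩) i hi
      = Function.update (prodSeq a i hi) ⟨i, by omega⟩
        (a ⟨i + 1, hi⟩ * a ⟨i, by omega⟩) := by
  funext t
  unfold prodSeq
  rcases lt_trichotomy (t : ℕ) i with ht | ht | ht
  · simp only [Function.update_apply, Fin.ext_iff, ht.ne, if_false, if_pos ht,
      Function.comp_apply]
    rw [Equiv.swap_apply_of_ne_of_ne] <;> simp [Fin.ext_iff] <;> omega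
  · simp [Function.update_apply, Fin.ext_iff, ht]
  · simp only [Function.update_apply, Fin.ext_iff, ht.ne', if_false, if_neg ht.not_gt,
      Function.comp_apply]
    rw [Equiv.swap_apply_of_ne_of_ne] <;> simp [Fin.ext_iff] <;> omega

/-- The elements of `Fin m` lying above `t` under `mergeMap`, in increasing order. -/
def mergeFiber (m i : ℕ) (hi : i + 1 < m) (t : Fin (m - 1)) : List (Fin m) :=
  if (t : ℕ) < i then [⟨t, by have := t.isLt; omega⟩]
  else if (t : ℕ) = i then [⟨i, by omega⟩, ⟨i + 1, hi⟩]
  else [⟨(t : ℕ) + 1, by have := t.isLt; omega⟩]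

theorem mem_mergeFiber {m i : ℕ} (hi : i + 1 < m) (t : Fin (m - 1)) (x : Fin m) :
    x ∈ mergeFiber m i hi t ↔ mergeMap m i hi x = t := by
  unfold mergeFiber mergeMap
  split_ifs <;> simp [Fin.ext_iff] <;> omega

theorem ordProd_prodSeq [Monoid A] {m i : ℕ} (hi : i + 1 < m) (a : Fin m → A)
    (B : Set (Fin (m - 1))) :
    ordProd a (mergeMap m i hi ⁻¹' B) = ordProd (prodSeq a i hi) B := by
  have hlist : (List.finRange m).filter (fun t => decide (t ∈ mergeMap m i hi ⁻¹' B))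
      = ((List.finRange (m - 1)).filter (fun t => decide (t ∈ B))).flatMap
          (mergeFiber m i hi) := by
    refine List.Pairwise.eq_of_mem_iff (r := (· < ·))
      ((List.pairwise_lt_finRange m).filter _) ?_ fun x => ?_
    · rw [List.pairwise_flatMap]
      refine ⟨fun t _ => ?_, ((List.pairwise_lt_finRange _).filter _).imp fun {s t} hst => ?_⟩
      · unfold mergeFiber
        split_ifs <;> simp
      · intro x hx y hy
        rw [mem_mergeFiber] at hx hy
        subst hx hy
        by_contra hxy
        rw [not_lt] at hxy
        refine absurd hst (not_lt.2 ?_)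
        rw [Fin.le_def] at hxy ⊢
        rw [val_mergeMap, val_mergeMap]
        split_ifs <;> omega
    · simp [mem_mergeFiber]
  unfold ordProd
  rw [hlist, List.map_flatMap, List.flatMap_def, List.prod_flatten, List.map_map]
  congr 1
  refine List.map_congr_left fun t _ => ?_
  simp only [Function.comp_apply, mergeFiber, prodSeq]
  split_ifs <;> simp

end Merge

section Cumulants

theorem IsCumulant.congr {R : Type*} [CommRing R] [Monoid A] {E : A → R}
    {k : ∀ {l : ℕ}, Setoid (Fin l) → (Fin l → A) → R} (hk : IsCumulant E k) {l : ℕ}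
    {a b : Fin l → A} (h : ∀ S, E (ordProd a S) = E (ordProd b S)) (V : Setoid (Fin l)) :
    k V a = k V b := by
  refine eq_of_sum_le_eq (F := fun V => k V a) (G := fun V => k V b) V fun U _ => ?_
  rw [hk, hk, momentV, momentV]
  simp only [h]

theorem IsCumulant.update_sub {R : Type*} [CommRing R] [Ring A] {E : A →+ R}
    {k : ∀ {l : ℕ}, Setoid (Fin l) → (Fin l → A) → R} (hk : IsCumulant E k) {l : ℕ}
    (V : Setoid (Fin l)) (a : Fin l → A) (j : Fin l) (x y : A) :
    k V (Function.update a j (x - y))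
      = k V (Function.update a j x) - k V (Function.update a j y) := by
  refine eq_of_sum_le_eq (F := fun V => k V (Function.update a j (x - y)))
    (G := fun V => k V (Function.update a j x) - k V (Function.update a j y)) V fun U _ => ?_
  rw [Finset.sum_sub_distrib, hk, hk, hk, momentV_update_sub]

/-- Exchanging two neighbouring arguments in different blocks does not change a cumulant. -/
theorem IsCumulant.comap_swap {R : Type*} [CommRing R] [Monoid A] {E : A → R}
    {k : ∀ {l : ℕ}, Setoid (Fin l) → (Fin l → A) → R} (hk : IsCumulant E k) {m i : ℕ}
    (hi : i + 1 < m) {V : Setoid (Fin m)} (hV : ¬ V ⟨i, by omega⟩ ⟨i + 1, hi⟩) (a : Fin m → A) :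
    k (V.comap (Equiv.swap ⟨i, by omega⟩ ⟨i + 1, hi⟩))
      (a ∘ Equiv.swap ⟨i, by omega⟩ ⟨i + 1, hi⟩) = k V a := by
  set τ := Equiv.swap (⟨i, by omega⟩ : Fin m) ⟨i + 1, hi⟩ with hτ
  refine eq_of_sum_le_eq (F := fun V : Setoid (Fin m) => k (V.comap τ) (a ∘ τ))
    (G := fun V => k V a) V fun U hU => ?_
  have hmom : momentV E (U.comap τ) (a ∘ τ) = momentV E U a := by
    refine momentV_congr E τ.surjective U _ _ fun B hB => ?_
    rw [ordProd_swap i hi a B]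
    exact fun h => hV (hU (U.rel_iff_exists_classes.2 ⟨B, hB, h⟩))
  rw [hk, ← hmom, ← hk]
  refine Finset.sum_bij' (fun W _ => W.comap τ) (fun W _ => W.comap (⇑τ⁻¹)) ?_ ?_ ?_ ?_ ?_
  · intro W hW
    simpa [comap_perm_le_iff] using hW
  · intro W hW
    have : (W.comap (⇑τ⁻¹)).comap τ ≤ U.comap τ := by simpa [comap_comap_inv] using hW
    simpa [comap_perm_le_iff] using this
  · intro W _
    simpa using comap_comap_inv τ⁻¹ W
  · intro W _
    exact comap_comap_inv τ W
  · intro W _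
    rfl

/-- The formula for cumulants with products as entries. -/
theorem IsCumulant.prodSeq {R : Type*} [CommRing R] [Monoid A] {E : A → R}
    {k : ∀ {l : ℕ}, Setoid (Fin l) → (Fin l → A) → R} (hk : IsCumulant E k) {m i : ℕ}
    (hi : i + 1 < m) (V : Setoid (Fin (m - 1))) (a : Fin m → A) :
    k V (prodSeq a i hi) = ∑ U ∈ Finset.univ.filter
      (fun U : Setoid (Fin m) => U.map (mergeMap m i hi) = V), k U a := by
  refine eq_of_sum_le_eq (F := fun V => k V (HOF.prodSeq a i hi))
    (G := fun V => ∑ U ∈ Finset.univ.filter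
      (fun U : Setoid (Fin m) => U.map (mergeMap m i hi) = V), k U a) V fun W _ => ?_
  rw [hk, ← momentV_congr E (mergeMap_surjective hi) W a _
    (fun B _ => by rw [ordProd_prodSeq]), ← hk,
    ← Finset.sum_fiberwise_of_maps_to (g := fun U : Setoid (Fin m) => U.map (mergeMap m i hi))
      (t := Finset.univ.filter (fun W' => W' ≤ W))
      (fun U hU => by simpa [map_le_iff_le_comap] using hU)]
  refine Finset.sum_congr rfl fun W' hW' => Finset.sum_congr ?_ fun _ _ => rfl
  ext U
  have hW'' : W' ≤ W := by simpa using hW'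
  simp only [Finset.mem_filter, Finset.mem_univ, true_and, and_iff_right_iff_imp]
  rintro rfl
  exact (map_le_iff_le_comap _ _ _).1 hW''

/-- Exchanging two neighbouring arguments in the same block changes a cumulant by the merged
cumulant of the commutator. -/
theorem IsCumulant.sub_swap {R : Type*} [CommRing R] [Ring A] {E : A →+ R}
    {k : ∀ {l : ℕ}, Setoid (Fin l) → (Fin l → A) → R} (hk : IsCumulant E k) {m i : ℕ}
    (hi : i + 1 < m) {V : Setoid (Fin m)} (hV : V ⟨i, by omega⟩ ⟨i + 1, hi⟩) (a : Fin m → A) :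
    k V a - k (V.comap (Equiv.swap ⟨i, by omega⟩ ⟨i + 1, hi⟩))
      (a ∘ Equiv.swap ⟨i, by omega⟩ ⟨i + 1, hi⟩)
      = k (mergeSetoid V i hi) (mergeSeq a i hi) := by
  set τ := Equiv.swap (⟨i, by omega⟩ : Fin m) ⟨i + 1, hi⟩ with hτ
  have hττ : τ⁻¹ = τ := Equiv.swap_inv _ _
  have hcc : ∀ U : Setoid (Fin m), (U.comap τ).comap τ = U := fun U => by
    simpa [hττ] using comap_comap_inv τ U
  rw [mergeSeq_eq_update, hk.update_sub, ← prodSeq_eq_update, ← prodSeq_swap_eq_update,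
    hk.prodSeq, hk.prodSeq]
  set S := Finset.univ.filter
    (fun U : Setoid (Fin m) => U.map (mergeMap m i hi) = mergeSetoid V i hi) with hS
  have hSτ : ∀ U ∈ S, U.comap τ ∈ S := fun U hU => by
    have hU' : U.map (mergeMap m i hi) = mergeSetoid V i hi := by simpa [hS] using hU
    simp [hS, map_comap_perm τ (mergeMap_comp_swap hi), hU']
  have hre : ∑ U ∈ S, k U (a ∘ τ) = ∑ U ∈ S, k (U.comap τ) (a ∘ τ) :=
    Finset.sum_bij' (fun U _ => U.comap τ) (fun U _ => U.comap τ) hSτ hSτ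
      (fun U _ => hcc U) (fun U _ => hcc U) (fun U _ => by rw [hcc])
  rw [hre, ← Finset.sum_sub_distrib, Finset.sum_eq_single V]
  · intro U hU hne
    rw [sub_eq_zero, hτ, hk.comap_swap hi]
    intro hUr
    apply hne
    have hU' : U.map (mergeMap m i hi) = mergeSetoid V i hi := by simpa [hS] using hU
    rw [← comap_mergeMap_mergeSetoid hi hUr, map_comap_of_surjective (mergeMap_surjective hi)]
      at hU'
    rw [← comap_mergeMap_mergeSetoid hi hUr, hU', comap_mergeMap_mergeSetoid hi hV]
  · intro hVS
    refine absurd ?_ hVS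
    have h := map_comap_of_surjective (mergeMap_surjective hi) (mergeSetoid V i hi)
    rw [comap_mergeMap_mergeSetoid hi hV] at h
    simpa [hS] using h

end Cumulants

section Invariance

theorem conjEntry_permMatrix [Ring A] [Algebra ℂ A] {n : ℕ} (ρ : Equiv.Perm (Fin n))
    (X : Matrix (Fin n) (Fin n) A) (i j : Fin n) :
    conjEntry (ρ.permMatrix ℂ) X i j = X (ρ i) (ρ j) := by
  simp [conjEntry, Equiv.Perm.permMatrix, PEquiv.toMatrix_apply, ite_smul]

theorem UnitarilyInvariant.expect_perm [Ring A] [Algebra ℂ A] {E : A → ℂ} {n : ℕ}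
    {X : Matrix (Fin n) (Fin n) A} (hX : UnitarilyInvariant E X) (ρ : Equiv.Perm (Fin n))
    {l : ℕ} (f g : Fin l → Fin n) (S : Set (Fin l)) :
    E (ordProd (fun t => X (f t) (g t)) S)
      = E (ordProd (fun t => X (ρ (f t)) (ρ (g t))) S) := by
  have hU : ρ.permMatrix ℂ ∈ Matrix.unitaryGroup (Fin n) ℂ := by
    rw [Matrix.mem_unitaryGroup_iff]
    ext a b
    simp [Matrix.mul_apply, Equiv.Perm.permMatrix, PEquiv.toMatrix_apply, Matrix.star_apply,
      Matrix.one_apply]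
  have hlist : ∀ (L : List (Fin l)) (c : Fin l → A),
      L.map c = List.ofFn (fun t : Fin L.length => c L[t]) := fun L c => by
    simp [List.map_ofFn.symm, ← Function.comp_def]
  unfold ordProd
  rw [hlist, hlist, ← hX _ hU _ (fun t => f _) (fun t => g _)]
  simp only [conjEntry_permMatrix]

theorem kappa_conj_swap [Ring A] [Algebra ℂ A] {E : A → ℂ} {n : ℕ}
    {k : ∀ {l : ℕ}, Setoid (Fin l) → (Fin l → A) → ℂ} (hk : IsCumulant E k)
    {X : Matrix (Fin n) (Fin n) A} (hX : UnitarilyInvariant E X) {m : ℕ} (h : m ≤ n)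
    (x y : Fin m) (V : Setoid (Fin m)) (π : Equiv.Perm (Fin m)) :
    kappa k X h V (Equiv.swap x y * π * Equiv.swap x y)
      = k V ((fun t => X (Fin.castLE h t) (Fin.castLE h (π t))) ∘ Equiv.swap x y) := by
  have hρ : ∀ z, Equiv.swap (Fin.castLE h x) (Fin.castLE h y) (Fin.castLE h z)
      = Fin.castLE h (Equiv.swap x y z) := (Fin.castLE_injective h).swap_apply x y
  refine (hk.congr (fun S => hX.expect_perm
    (Equiv.swap (Fin.castLE h x) (Fin.castLE h y)) _ _ S) V).trans ?_
  congr 1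
  funext t
  simp [hρ]

theorem tendsto_kappaSeq_swap {A : ℕ → Type*} [∀ n, Ring (A n)] [∀ n, Algebra ℂ (A n)]
    {E : ∀ n, A n →ₗ[ℂ] ℂ} {k : ∀ n, ∀ {l : ℕ}, Setoid (Fin l) → (Fin l → A n) → ℂ}
    (hk : ∀ n, IsCumulant (⇑(E n)) (@k n)) {X : ∀ n, Matrix (Fin n) (Fin n) (A n)}
    (hX : ∀ n, UnitarilyInvariant (⇑(E n)) (X n))
    {m₀ : ℕ} (hcomm : AsympVanishingComm (fun n => @k n) X m₀) {m : ℕ} (hm : m ≤ m₀)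
    {i : ℕ} (hi : i + 1 < m) {V : Setoid (Fin m)} {π : Equiv.Perm (Fin m)}
    (hπ : permLePartition π V) :
    Tendsto (fun n : ℕ => (n : ℂ) ^ (ppLen V π) *
      (kappaSeq (fun n => @k n) X V π n
        - kappaSeq (fun n => @k n) X (V.comap (Equiv.swap ⟨i, by omega⟩ ⟨i + 1, hi⟩))
          (Equiv.swap ⟨i, by omega⟩ ⟨i + 1, hi⟩ * π * Equiv.swap ⟨i, by omega⟩ ⟨i + 1, hi⟩) n))
      atTop (nhds 0) := by
  have hk' : ∀ n, IsCumulant (⇑((E n : A n →+ ℂ))) (@k n) := hk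
  by_cases hV : V ⟨i, by omega⟩ ⟨i + 1, hi⟩
  · refine (hcomm m hm V π hπ i hi hV).congr fun n => ?_
    congr 1
    by_cases hn : m ≤ n
    · simp only [kappaSeq, dif_pos hn, kappa_conj_swap (hk n) (hX n)]
      exact ((hk' n).sub_swap hi hV _).symm
    · simp [kappaSeq, hn]
  · refine tendsto_const_nhds.congr fun n => ?_
    by_cases hn : m ≤ n
    · simp only [kappaSeq, dif_pos hn, kappa_conj_swap (hk n) (hX n), (hk n).comap_swap hi hV]
      simp [kappa]
    · simp [kappaSeq, hn]

theorem perm_induction_swap_succ {m : ℕ} {P : Equiv.Perm (Fin m) → Prop} (one : P 1)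
    (swap : ∀ (i : ℕ) (hi : i + 1 < m), P (Equiv.swap ⟨i, by omega⟩ ⟨i + 1, hi⟩))
    (mul : ∀ σ τ, P σ → P τ → P (σ * τ)) (σ : Equiv.Perm (Fin m)) : P σ := by
  cases m with
  | zero => exact Subsingleton.elim 1 σ ▸ one
  | succ m =>
    have hσ : σ ∈ Submonoid.closure
        (Set.range fun i : Fin m => Equiv.swap i.castSucc i.succ) := by
      rw [Equiv.Perm.mclosure_swap_castSucc_succ]
      trivial
    induction hσ using Submonoid.closure_induction with
    | mem _ h =>
      obtain ⟨i, rfl⟩ := h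
      exact swap i (by omega)
    | one => exact one
    | mul _ _ _ _ ih₁ ih₂ => exact mul _ _ ih₁ ih₂

end Invariance

open scoped ComplexOrder in
/-- For a sequence of unitarily invariant random matrices with noncommutative
entries with asymptotically vanishing commutators up to degree `m₀`, whose rescaled entry
cumulants converge for all partitioned permutations of `{1,…,m}`, `m < m₀`, the rescaled
difference of `κ`'s over conjugate partitioned permutations of `{1,…,m}`, `m ≤ m₀`, tends to `0`. -/
theorem kappa_conjugation_invariance
    {A : ℕ → Type*} [∀ n, Ring (A n)] [∀ n, Algebra ℂ (A n)] [∀ n, StarRing (A n)]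
    (E : ∀ n, A n →ₗ[ℂ] ℂ) (hE1 : ∀ n, E n 1 = 1)
    (hEpos : ∀ n (x : A n), x ≠ 0 → 0 < E n (star x * x))
    (k : ∀ n, ∀ {l : ℕ}, Setoid (Fin l) → (Fin l → A n) → ℂ)
    (hk : ∀ n, IsCumulant (⇑(E n)) (@k n))
    (X : ∀ n, Matrix (Fin n) (Fin n) (A n))
    (hX : ∀ n, UnitarilyInvariant (⇑(E n)) (X n))
    (m₀ : ℕ) (hcomm : AsympVanishingComm (fun n => @k n) X m₀)
    (hK : ∀ (m : ℕ), m < m₀ → ∀ (V : Setoid (Fin m)) (π : Equiv.Perm (Fin m)),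
      permLePartition π V → ∃ K : ℂ,
        Tendsto (fun n : ℕ => (n : ℂ) ^ (ppLen V π) * kappaSeq (fun n => @k n) X V π n)
          atTop (nhds K)) :
    ∀ (m : ℕ), m ≤ m₀ →
      ∀ (V : Setoid (Fin m)) (π : Equiv.Perm (Fin m)) (W : Setoid (Fin m))
        (σ : Equiv.Perm (Fin m)), permLePartition π V → permLePartition σ W →
        ppConj V π W σ →
        Tendsto (fun n : ℕ => (n : ℂ) ^ (ppLen V π) *
            (kappaSeq (fun n => @k n) X V π n - kappaSeq (fun n => @k n) X W σ n))
          atTop (nhds 0) := by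
  intro m hm V π W σ hπ _ ⟨ρ, hσ, hW⟩
  obtain rfl : W = V.comap (⇑ρ⁻¹) := Setoid.ext hW
  subst hσ
  induction ρ using perm_induction_swap_succ generalizing V π with
  | one =>
    have hV : V.comap (⇑(1 : Equiv.Perm (Fin m))⁻¹) = V := rfl
    rw [hV, one_mul, inv_one, mul_one]
    simp
  | swap i hi =>
    rw [Equiv.swap_inv]
    exact tendsto_kappaSeq_swap hk hX hcomm hm hi hπ
  | mul ρ τ ihρ ihτ =>
    have h₁ := ihτ V π hπ (fun _ _ => Iff.rfl) (permLePartition_conj τ hπ)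
    have hπ' := permLePartition_conj τ hπ
    have h₂ := ihρ _ _ hπ' (fun _ _ => Iff.rfl) (permLePartition_conj ρ hπ')
    rw [ppLen_conj] at h₂
    have h := h₁.add h₂
    rw [add_zero] at h
    refine h.congr fun n => ?_
    rw [← mul_add, sub_add_sub_cancel]
    simp only [mul_inv_rev, mul_assoc]
    rfl

end HOF
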